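/- Let Ω ⊆ ℝ³ be a bounded convex open set, α ≥ 0, β ∈ ℝ, −3 < γ ≤ 1, 2 ≤ p < ∞, B₀ > 0, and let ν be the collision frequency. Then there exists a constant C > 0 such that for every measurable h : Ω × ℝ³ → ℝ, ∫_Ω ∫_{ℝ³} |S_Ω h(x, v)|^p e^{pα|v|²} (1 + |v|)^{p(β+1)} dv dx ≤ C ∫_Ω ∫_{ℝ³} |h(x, v)|^p e^{pα|v|²} (1 + |v|)^{pβ} dv dx. -/

import Mathlib

open MeasureTheory Real Set
open scoped ENNReal

noncomputable section

/-- `ℝ³` as a Euclidean space. -/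
abbrev E3 : Type := EuclideanSpace ℝ (Fin 3)

/-- The collision frequency `ν(v) = B₀ π ∫_{ℝ³} |v − w|^γ e^{−|w|²} dw`. -/
def nu (B₀ γ : ℝ) (v : E3) : ℝ :=
  B₀ * π * ∫ w : E3, ‖v - w‖ ^ γ * Real.exp (-‖w‖ ^ 2)

/-- The backward exit time `τ₋(x, v) = inf {t > 0 : x − t v ∉ Ω}` (equal to `+∞` if
no such `t` exists). -/
def tauMinus (Ω : Set E3) (x v : E3) : ℝ≥0∞ :=
  sInf (ENNReal.ofReal '' {t : ℝ | 0 < t ∧ x - t • v ∉ Ω})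

/-- The interval of integration `(0, τ₋(x,v))`. -/
def tauItv (Ω : Set E3) (x v : E3) : Set ℝ :=
  {t : ℝ | 0 < t ∧ ENNReal.ofReal t < tauMinus Ω x v}

/-- The operator `S_Ω h(x,v) = ∫₀^{τ₋(x,v)} e^{−ν(v)t} h(x − tv, v) dt`. -/
def SOm (Ω : Set E3) (B₀ γ : ℝ) (h : E3 → E3 → ℝ) (x v : E3) : ℝ :=
  ∫ t in tauItv Ω x v, Real.exp (-(nu B₀ γ v) * t) * h (x - t • v) v

/-- Jensen's inequality for the finite measure with density `k`. -/
lemma lintegral_mul_rpow_le {k g : ℝ → ℝ≥0∞} (hk : Measurable k) (hg : Measurable g)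
    {p : ℝ} (hp : 1 < p) :
    (∫⁻ t, k t * g t) ^ p ≤ (∫⁻ t, k t) ^ (p - 1) * ∫⁻ t, k t * g t ^ p := by
  have hpq := Real.HolderConjugate.conjExponent hp
  have hp0 : 0 < p := by linarith
  have key := ENNReal.lintegral_mul_le_Lp_mul_Lq (volume.withDensity k) hpq
    hg.aemeasurable (aemeasurable_const (b := (1 : ℝ≥0∞)))
  rw [lintegral_withDensity_eq_lintegral_mul _ hk (by fun_prop),
    lintegral_withDensity_eq_lintegral_mul _ hk (by fun_prop),
    lintegral_withDensity_eq_lintegral_mul _ hk (by fun_prop)] at key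
  simp only [Pi.mul_apply, mul_one, ENNReal.one_rpow] at key
  have h2 := ENNReal.rpow_le_rpow key hp0.le
  rw [ENNReal.mul_rpow_of_nonneg _ _ hp0.le, ← ENNReal.rpow_mul, ← ENNReal.rpow_mul,
    one_div_mul_cancel hp0.ne', ENNReal.rpow_one, mul_comm] at h2
  have h3 : 1 / p.conjExponent * p = p - 1 := by
    have : p - 1 ≠ 0 := by linarith
    rw [Real.conjExponent]; field_simp
  rwa [h3] at h2

lemma integrable_norm_sub_rpow_mul_exp {γ : ℝ} (hγ : -3 < γ) (v : E3) :
    Integrable fun w : E3 => ‖v - w‖ ^ γ * Real.exp (-‖w‖ ^ 2) := by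
  have h1 : Integrable fun w : E3 => ‖w‖ ^ γ * Real.exp (-(1 / 2) * ‖w‖ ^ 2) := by
    have := (integrable_fun_norm_addHaar (volume : Measure E3)
      (f := fun r : ℝ => r ^ γ * Real.exp (-(1 / 2) * r ^ 2))).2 ?_
    · exact this
    · refine (integrableOn_rpow_mul_exp_neg_mul_sq (b := 1 / 2) (by norm_num)
        (s := γ + 2) (by linarith)).congr_fun ?_ measurableSet_Ioi
      intro r hr
      have hr : (0 : ℝ) < r := hr
      simp only [finrank_euclideanSpace, Fintype.card_fin, smul_eq_mul]
      rw [Real.rpow_add hr]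
      norm_num
      ring
  have h2 := (h1.comp_sub_left v).const_mul (Real.exp (‖v‖ ^ 2))
  refine h2.mono' (by fun_prop) (ae_of_all _ fun w => ?_)
  rw [Real.norm_of_nonneg (by positivity), mul_left_comm, ← Real.exp_add]
  gcongr
  nlinarith [norm_sub_le v w, sq_nonneg (‖v‖ - ‖w‖), norm_nonneg (v - w), norm_nonneg v,
    norm_nonneg w]

lemma nu_nonneg {B₀ : ℝ} (hB₀ : 0 < B₀) (γ : ℝ) (v : E3) : 0 ≤ nu B₀ γ v :=
  mul_nonneg (by positivity) (integral_nonneg fun w => by positivity)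

lemma exists_pos_le_nu {B₀ γ : ℝ} (hB₀ : 0 < B₀) (hγ : -3 < γ) :
    ∃ c > 0, ∀ v : E3, ‖v‖ < 1 → c ≤ nu B₀ γ v := by
  obtain ⟨w₀, hw₀⟩ : ∃ w₀ : E3, ‖w₀‖ = 3 := exists_norm_eq E3 (by norm_num)
  have hpos : 0 < (volume : Measure E3).real (Metric.ball w₀ 1) :=
    ENNReal.toReal_pos (Metric.measure_ball_pos _ _ one_pos).ne' measure_ball_lt_top.ne
  refine ⟨B₀ * π * ((5 : ℝ) ^ (-3 : ℝ) * Real.exp (-4 ^ 2) *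
    (volume : Measure E3).real (Metric.ball w₀ 1)), by positivity, fun v hv => ?_⟩
  have hint := integrable_norm_sub_rpow_mul_exp hγ v
  unfold nu
  gcongr
  refine (setIntegral_ge_of_const_le_real Metric.isOpen_ball.measurableSet
    measure_ball_lt_top.ne (fun w hw => ?_) hint.integrableOn).trans
    (setIntegral_le_integral hint (ae_of_all _ fun w => by positivity))
  rw [mem_ball_iff_norm] at hw
  have a1 := norm_sub_norm_le w w₀
  have a2 := norm_sub_norm_le w₀ w
  rw [norm_sub_rev] at a2
  have a3 := norm_sub_norm_le w v
  rw [norm_sub_rev] at a3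
  have a4 := norm_sub_le v w
  have h1 : 1 ≤ ‖v - w‖ := by linarith
  have h5 : ‖v - w‖ ≤ 5 := by linarith
  refine mul_le_mul ?_ ?_ (by positivity) (by positivity)
  · calc (5 : ℝ) ^ (-3 : ℝ) ≤ ‖v - w‖ ^ (-3 : ℝ) :=
          Real.rpow_le_rpow_of_nonpos (by linarith) h5 (by norm_num)
      _ ≤ ‖v - w‖ ^ γ := Real.rpow_le_rpow_of_exponent_le h1 hγ.le
  · gcongr
    linarith

/-- A kernel dominating `e^{-ν(v)t}` on the interval of integration `(0, τ₋(x,v))`. -/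
def majorant (c D : ℝ) (v : E3) (t : ℝ) : ℝ≥0∞ :=
  if 0 < t then
    if ‖v‖ < 1 then ENNReal.ofReal (Real.exp (-c * t)) else if t * ‖v‖ ≤ D then 1 else 0
  else 0

lemma measurable_majorant (c D : ℝ) : Measurable fun q : E3 × ℝ => majorant c D q.1 q.2 := by
  unfold majorant
  refine Measurable.ite (measurableSet_lt (by fun_prop) (by fun_prop))
    (Measurable.ite (measurableSet_lt (by fun_prop) (by fun_prop)) (by fun_prop)
      (Measurable.ite (measurableSet_le (by fun_prop) (by fun_prop)) ?_ ?_)) ?_ <;>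
  exact measurable_const

lemma lintegral_majorant_le {c D : ℝ} (hc : 0 < c) (hD : 0 ≤ D) (v : E3) :
    ∫⁻ t, majorant c D v t ≤ ENNReal.ofReal ((2 / c + 2 * D) / (1 + ‖v‖)) := by
  by_cases hv : ‖v‖ < 1
  · have h1 : ∀ t, majorant c D v t =
        (Ioi (0 : ℝ)).indicator (fun t => ENNReal.ofReal (Real.exp (-c * t))) t := by
      intro t
      simp [majorant, hv, indicator]
    simp_rw [h1]
    rw [lintegral_indicator measurableSet_Ioi, ← ofReal_integral_eq_lintegral_ofReal
      (exp_neg_integrableOn_Ioi 0 hc) (ae_of_all _ fun t => by positivity),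
      integral_exp_mul_Ioi (by linarith)]
    refine ENNReal.ofReal_le_ofReal ?_
    rw [le_div_iff₀ (by positivity)]
    have : -Real.exp (-c * 0) / -c = 1 / c := by simp
    rw [this]
    calc 1 / c * (1 + ‖v‖) ≤ 1 / c * 2 := by gcongr; linarith
      _ ≤ 2 / c + 2 * D := by rw [one_div_mul_eq_div]; linarith
  · have hv1 : 1 ≤ ‖v‖ := not_lt.1 hv
    have hv0 : 0 < ‖v‖ := by linarith
    have h1 : ∀ t, majorant c D v t = (Ioc (0 : ℝ) (D / ‖v‖)).indicator 1 t := by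
      intro t
      by_cases ht : 0 < t <;> simp [majorant, hv, indicator, ht, le_div_iff₀ hv0]
    simp_rw [h1]
    rw [lintegral_indicator_one measurableSet_Ioc, Real.volume_Ioc, sub_zero]
    refine ENNReal.ofReal_le_ofReal ?_
    rw [div_le_div_iff₀ hv0 (by positivity)]
    have : 0 ≤ 2 / c := by positivity
    nlinarith [mul_nonneg this hv0.le, mul_nonneg hD (sub_nonneg.2 hv1)]

lemma sub_smul_mem_of_mem_tauItv {Ω : Set E3} {x v : E3} {t : ℝ} (ht : t ∈ tauItv Ω x v) :
    x - t • v ∈ Ω := by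
  by_contra h
  have hle : tauMinus Ω x v ≤ ENNReal.ofReal t := sInf_le ⟨t, ⟨ht.1, h⟩, rfl⟩
  exact hle.not_gt ht.2

lemma measurableSet_tauItv (Ω : Set E3) (x v : E3) : MeasurableSet (tauItv Ω x v) :=
  measurableSet_Ioi.inter (measurableSet_lt ENNReal.measurable_ofReal measurable_const)

lemma enorm_SOm_le {Ω : Set E3} {B₀ γ c D : ℝ} (hB₀ : 0 < B₀)
    (hc : ∀ v : E3, ‖v‖ < 1 → c ≤ nu B₀ γ v)
    (hD : ∀ x ∈ Ω, ∀ y ∈ Ω, dist x y ≤ D) (h : E3 → E3 → ℝ) {x : E3} (hx : x ∈ Ω) (v : E3) :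
    ‖SOm Ω B₀ γ h x v‖ₑ ≤
      ∫⁻ t, majorant c D v t * Ω.indicator (fun y => ‖h y v‖ₑ) (x - t • v) := by
  refine (enorm_integral_le_lintegral_enorm _).trans ?_
  refine le_trans (setLIntegral_mono' (measurableSet_tauItv Ω x v) fun t ht => ?_)
    (setLIntegral_le_lintegral _ _)
  have hmem := sub_smul_mem_of_mem_tauItv ht
  have ht0 : 0 < t := ht.1
  rw [indicator_of_mem hmem, enorm_mul]
  gcongr
  rw [Real.enorm_eq_ofReal (Real.exp_pos _).le, majorant, if_pos ht0]
  split_ifs with h1 h2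
  · gcongr
    exact hc v h1
  · rw [ENNReal.ofReal_le_one, Real.exp_le_one_iff]
    nlinarith [mul_nonneg (nu_nonneg hB₀ γ v) ht0.le]
  · refine absurd ?_ h2
    have := hD x hx _ hmem
    rwa [dist_eq_norm, sub_sub_cancel, norm_smul, Real.norm_of_nonneg ht0.le] at this

lemma lintegral_lintegral_SOm_le {Ω : Set E3} (hΩ : MeasurableSet Ω) {B₀ γ c D p : ℝ}
    (hB₀ : 0 < B₀) (hc0 : 0 < c) (hc : ∀ v : E3, ‖v‖ < 1 → c ≤ nu B₀ γ v) (hD0 : 0 ≤ D)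
    (hD : ∀ x ∈ Ω, ∀ y ∈ Ω, dist x y ≤ D) (hp : 1 < p) {h : E3 → E3 → ℝ}
    (hh : Measurable (Function.uncurry h)) {W : E3 → ℝ≥0∞} (hW : Measurable W) :
    ∫⁻ x in Ω, ∫⁻ v, ‖SOm Ω B₀ γ h x v‖ₑ ^ p * W v ≤
      ∫⁻ x in Ω, ∫⁻ v, ‖h x v‖ₑ ^ p *
        (ENNReal.ofReal ((2 / c + 2 * D) / (1 + ‖v‖)) ^ p * W v) := by
  set M : E3 → ℝ≥0∞ := fun v => ENNReal.ofReal ((2 / c + 2 * D) / (1 + ‖v‖))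
  have hMm : Measurable M := by fun_prop
  have hp0 : 0 < p := by linarith
  set H : E3 → E3 → ℝ≥0∞ := fun y v => Ω.indicator (fun y => ‖h y v‖ₑ) y
  have hHm : Measurable (Function.uncurry H) := by
    have : Function.uncurry H =
        (Ω ×ˢ (univ : Set E3)).indicator (fun q => ‖Function.uncurry h q‖ₑ) := by
      ext ⟨y, v⟩
      by_cases hy : y ∈ Ω <;> simp [H, hy, Function.uncurry]
    rw [this]
    exact hh.enorm.indicator (hΩ.prod MeasurableSet.univ)
  have hkm := measurable_majorant c D
  have hHc : Measurable fun q : (E3 × E3) × ℝ => H (q.1.1 - q.2 • q.1.2) q.1.2 :=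
    hHm.comp (f := fun q : (E3 × E3) × ℝ => (q.1.1 - q.2 • q.1.2, q.1.2)) (by fun_prop)
  have hkc : Measurable fun q : (E3 × E3) × ℝ => majorant c D q.1.2 q.2 :=
    hkm.comp (f := fun q : (E3 × E3) × ℝ => (q.1.2, q.2)) (by fun_prop)
  have hF : Measurable fun q : (E3 × E3) × ℝ =>
      majorant c D q.1.2 q.2 * H (q.1.1 - q.2 • q.1.2) q.1.2 ^ p :=
    hkc.mul (hHc.pow_const p)
  have pointwise : ∀ x ∈ Ω, ∀ v, ‖SOm Ω B₀ γ h x v‖ₑ ^ p * W v ≤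
      (M v ^ (p - 1) * W v) * ∫⁻ t, majorant c D v t * H (x - t • v) v ^ p := by
    intro x hx v
    have h1 := ENNReal.rpow_le_rpow (enorm_SOm_le hB₀ hc hD h hx v) hp0.le
    have h2 := lintegral_mul_rpow_le (k := majorant c D v) (g := fun t => H (x - t • v) v)
      (hkm.comp (measurable_prodMk_left (x := v)))
      (hHc.comp (measurable_prodMk_left (x := (x, v)))) hp
    calc ‖SOm Ω B₀ γ h x v‖ₑ ^ p * W v
        ≤ ((∫⁻ t, majorant c D v t) ^ (p - 1) *
            ∫⁻ t, majorant c D v t * H (x - t • v) v ^ p) * W v := by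
          gcongr
          exact h1.trans h2
      _ ≤ (M v ^ (p - 1) * ∫⁻ t, majorant c D v t * H (x - t • v) v ^ p) * W v := by
          gcongr
          exact lintegral_majorant_le hc0 hD0 v
      _ = _ := by ring
  calc ∫⁻ x in Ω, ∫⁻ v, ‖SOm Ω B₀ γ h x v‖ₑ ^ p * W v
      ≤ ∫⁻ x in Ω, ∫⁻ v,
          (M v ^ (p - 1) * W v) * ∫⁻ t, majorant c D v t * H (x - t • v) v ^ p :=
        setLIntegral_mono' hΩ fun x hx => lintegral_mono (pointwise x hx)
    _ ≤ ∫⁻ x, ∫⁻ v,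
          (M v ^ (p - 1) * W v) * ∫⁻ t, majorant c D v t * H (x - t • v) v ^ p :=
        setLIntegral_le_lintegral _ _
    _ = ∫⁻ v, ∫⁻ x,
          (M v ^ (p - 1) * W v) * ∫⁻ t, majorant c D v t * H (x - t • v) v ^ p := by
        refine lintegral_lintegral_swap (Measurable.aemeasurable ?_)
        exact (by fun_prop : Measurable fun q : E3 × E3 => M q.2 ^ (p - 1) * W q.2).mul
          hF.lintegral_prod_right'
    _ ≤ ∫⁻ v, ∫⁻ x, H x v ^ p * (M v ^ p * W v) := by
        refine lintegral_mono fun v => ?_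
        have hHv : Measurable fun x => H x v ^ p :=
          (hHm.comp (measurable_prodMk_right (y := v))).pow_const p
        have hFv : Measurable fun q : E3 × ℝ =>
            majorant c D v q.2 * H (q.1 - q.2 • v) v ^ p :=
          hF.comp (f := fun q : E3 × ℝ => ((q.1, v), q.2)) (by fun_prop)
        have hkv : Measurable (majorant c D v) := hkm.comp (measurable_prodMk_left (x := v))
        have inner : ∀ t : ℝ, ∫⁻ x, majorant c D v t * H (x - t • v) v ^ p =
            majorant c D v t * ∫⁻ x, H x v ^ p := fun t => by
          have hHt : Measurable fun x => H (x - t • v) v ^ p :=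
            hHv.comp (f := fun x => x - t • v) (by fun_prop)
          rw [lintegral_const_mul _ hHt]
          congr 1
          exact lintegral_sub_right_eq_self (fun x => H x v ^ p) (t • v)
        rw [lintegral_const_mul _ hFv.lintegral_prod_right',
          lintegral_lintegral_swap hFv.aemeasurable, lintegral_mul_const _ hHv]
        simp_rw [inner]
        rw [lintegral_mul_const _ hkv]
        have hMp : M v ^ (p - 1) * M v = M v ^ p := by
          conv_lhs => rw [← ENNReal.rpow_one (M v), ← ENNReal.rpow_mul, one_mul]
          rw [← ENNReal.rpow_add_of_nonneg _ _ (by linarith) zero_le_one, sub_add_cancel]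
        calc M v ^ (p - 1) * W v * ((∫⁻ t, majorant c D v t) * ∫⁻ x, H x v ^ p)
            ≤ M v ^ (p - 1) * W v * (M v * ∫⁻ x, H x v ^ p) := by
              gcongr
              exact lintegral_majorant_le hc0 hD0 v
          _ = (∫⁻ x, H x v ^ p) * (M v ^ (p - 1) * M v * W v) := by ring
          _ = _ := by rw [hMp]
    _ = ∫⁻ x, ∫⁻ v, H x v ^ p * (M v ^ p * W v) := by
        refine (lintegral_lintegral_swap (Measurable.aemeasurable ?_)).symm
        exact (hHm.pow_const p).mul
          (by fun_prop : Measurable fun q : E3 × E3 => M q.2 ^ p * W q.2)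
    _ = _ := by
        rw [← lintegral_indicator hΩ]
        congr 1
        ext x
        by_cases hx : x ∈ Ω <;> simp [H, M, hx, hp0]

/-- Boundedness of `S_Ω` from `L^p_{α,β}(Ω × ℝ³)` to `L^p_{α,β+1}(Ω × ℝ³)`. -/
theorem SOmega_Lp_bounded (Ω : Set E3) (hΩo : IsOpen Ω) (hΩb : Bornology.IsBounded Ω)
    (hΩc : Convex ℝ Ω) (α β γ p B₀ : ℝ) (hα : 0 ≤ α) (hγl : -3 < γ) (hγu : γ ≤ 1)
    (hp : 2 ≤ p) (hB₀ : 0 < B₀) :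
    ∃ C > (0 : ℝ), ∀ h : E3 → E3 → ℝ, Measurable (Function.uncurry h) →
      (∫⁻ x in Ω, ∫⁻ v : E3, ENNReal.ofReal
          (|SOm Ω B₀ γ h x v| ^ p * Real.exp (p * α * ‖v‖ ^ 2) * (1 + ‖v‖) ^ (p * (β + 1)))) ≤
        ENNReal.ofReal C * ∫⁻ x in Ω, ∫⁻ v : E3, ENNReal.ofReal
          (|h x v| ^ p * Real.exp (p * α * ‖v‖ ^ 2) * (1 + ‖v‖) ^ (p * β)) := by
  obtain ⟨c, hc0, hc⟩ := exists_pos_le_nu hB₀ hγl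
  obtain ⟨D', hD'⟩ := Metric.isBounded_iff.1 hΩb
  have hD : ∀ x ∈ Ω, ∀ y ∈ Ω, dist x y ≤ max D' 0 :=
    fun x hx y hy => (hD' hx hy).trans (le_max_left _ _)
  have hA : 0 < 2 / c + 2 * max D' 0 := by positivity
  refine ⟨(2 / c + 2 * max D' 0) ^ p, by positivity, fun h hh => ?_⟩
  have split : ∀ a b w : ℝ, 0 ≤ b → 0 ≤ w →
      ENNReal.ofReal (|a| ^ p * b * w) = ‖a‖ₑ ^ p * ENNReal.ofReal (b * w) := by
    intro a b w hb hw
    rw [mul_assoc, ENNReal.ofReal_mul (by positivity), Real.enorm_eq_ofReal_abs,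
      ENNReal.ofReal_rpow_of_nonneg (abs_nonneg a) (by linarith)]
  have split' : ∀ (a : ℝ) (v : E3) (s : ℝ),
      ENNReal.ofReal (|a| ^ p * Real.exp (p * α * ‖v‖ ^ 2) * (1 + ‖v‖) ^ s) =
        ‖a‖ₑ ^ p * ENNReal.ofReal (Real.exp (p * α * ‖v‖ ^ 2) * (1 + ‖v‖) ^ s) :=
    fun a v s => split _ _ _ (by positivity) (by positivity)
  simp_rw [split']
  refine (lintegral_lintegral_SOm_le hΩo.measurableSet hB₀ hc0 hc (le_max_right _ _) hD
    (by linarith) hh (by fun_prop)).trans_eq ?_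
  rw [← lintegral_const_mul' _ _ ENNReal.ofReal_ne_top]
  congr 1
  ext x
  rw [← lintegral_const_mul' _ _ ENNReal.ofReal_ne_top]
  congr 1
  ext v
  rw [mul_left_comm (ENNReal.ofReal ((2 / c + 2 * max D' 0) ^ p))]
  congr 1
  rw [ENNReal.ofReal_rpow_of_nonneg (by positivity) (by linarith),
    ← ENNReal.ofReal_mul (by positivity), ← ENNReal.ofReal_mul (by positivity)]
  congr 1
  have hv : 0 < 1 + ‖v‖ := by positivity
  rw [Real.div_rpow hA.le hv.le, mul_add, mul_one, Real.rpow_add hv]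
  field_simp
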